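/- Let K : ℝ² \ {0} → ℝ be continuous, even, homogeneous of degree −2, with zero mean on S¹, and let D ⊆ ℝ² be measurable. Let H⁻ = {y : y₂ < 0}. Then for 0 < ε < δ: |∫_{D ∩ {ε<|y|<δ}} K(y) dy| ≤ (sup_{|θ|=1}|K(θ)|) · ∫₀^δ σ{θ ∈ S¹ : ρθ ∈ (D \ H⁻) ∪ (H⁻ \ D)} dρ/ρ, where σ is arc-length on S¹. -/

import Mathlib

open MeasureTheory Set

/-- The point with polar coordinates `(ρ, θ)`. -/
noncomputable def polarPt (ρ θ : ℝ) : EuclideanSpace ℝ (Fin 2) :=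
  (WithLp.equiv 2 (Fin 2 → ℝ)).symm ![ρ * Real.cos θ, ρ * Real.sin θ]

/-- The identification of `ℝ × ℝ` with the Euclidean plane. -/
noncomputable def planeEquiv : ℝ × ℝ ≃ᵐ EuclideanSpace ℝ (Fin 2) :=
  MeasurableEquiv.finTwoArrow.symm.trans (MeasurableEquiv.toLp 2 (Fin 2 → ℝ))

theorem planeEquiv_mp : MeasurePreserving planeEquiv volume volume :=
  (PiLp.volume_preserving_toLp (Fin 2)).comp (volume_preserving_finTwoArrow ℝ).symm

theorem planeEquiv_polar (p : ℝ × ℝ) :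
    planeEquiv (polarCoord.symm p) = polarPt p.1 p.2 := by
  ext i
  fin_cases i <;> simp [planeEquiv, polarPt, polarCoord, MeasurableEquiv.finTwoArrow]

theorem polarPt_norm {ρ : ℝ} (hρ : 0 < ρ) (θ : ℝ) : ‖polarPt ρ θ‖ = ρ := by
  have h : (ρ * Real.cos θ) ^ 2 + (ρ * Real.sin θ) ^ 2 = ρ ^ 2 := by
    have := Real.sin_sq_add_cos_sq θ
    linear_combination ρ ^ 2 * this
  simp [polarPt, EuclideanSpace.norm_eq, h, Real.sqrt_sq hρ.le]

theorem polarPt_smul (ρ θ : ℝ) : polarPt ρ θ = ρ • polarPt 1 θ := by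
  ext i
  fin_cases i <;> simp [polarPt]

theorem polarPt_ne {ρ : ℝ} (hρ : 0 < ρ) (θ : ℝ) : polarPt ρ θ ≠ 0 := by
  rw [← norm_pos_iff, polarPt_norm hρ]; exact hρ

theorem polarPt_continuous : Continuous (fun p : ℝ × ℝ => polarPt p.1 p.2) := by
  have : (fun p : ℝ × ℝ => polarPt p.1 p.2) =
      fun p : ℝ × ℝ => WithLp.toLp 2 ![p.1 * Real.cos p.2, p.1 * Real.sin p.2] := rfl
  rw [this]
  refine (PiLp.continuous_toLp 2 _).comp (continuous_pi fun i => ?_)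
  fin_cases i <;> simp <;> fun_prop

theorem polarPt_add_pi (ρ θ : ℝ) : polarPt ρ (θ + Real.pi) = -polarPt ρ θ := by
  ext i
  fin_cases i <;> simp [polarPt]

theorem polarPt_periodic (ρ : ℝ) : Function.Periodic (polarPt ρ) (2 * Real.pi) := by
  intro θ
  simp [polarPt]

theorem polar_integral (f : EuclideanSpace ℝ (Fin 2) → ℝ) :
    ∫ y, f y = ∫ p in Ioi (0:ℝ) ×ˢ Ioo (-Real.pi) Real.pi, p.1 * f (polarPt p.1 p.2) := by
  rw [← planeEquiv_mp.integral_comp planeEquiv.measurableEmbedding,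
    ← integral_comp_polarCoord_symm]
  simp only [planeEquiv_polar, smul_eq_mul]
  rfl

theorem polar_lintegral (f : EuclideanSpace ℝ (Fin 2) → ENNReal) :
    ∫⁻ y, f y = ∫⁻ p in Ioi (0:ℝ) ×ˢ Ioo (-Real.pi) Real.pi,
      ENNReal.ofReal p.1 * f (polarPt p.1 p.2) := by
  rw [← planeEquiv_mp.lintegral_comp_emb planeEquiv.measurableEmbedding,
    ← lintegral_comp_polarCoord_symm]
  simp only [planeEquiv_polar, smul_eq_mul]
  rfl

theorem measure_shift (ρ : ℝ) (S : Set (EuclideanSpace ℝ (Fin 2))) (hS : MeasurableSet S) :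
    volume ({θ | polarPt ρ θ ∈ S} ∩ Ioo (-Real.pi) Real.pi) ≤
      volume {θ ∈ Ico (0:ℝ) (2 * Real.pi) | polarPt ρ θ ∈ S} := by
  have hA : MeasurableSet {θ | polarPt ρ θ ∈ S} :=
    (polarPt_continuous.comp (Continuous.prodMk_right ρ)).measurable hS
  have h2 : (0:ℝ) < 2 * Real.pi := by positivity
  have key := (isAddFundamentalDomain_Ioc h2 (-Real.pi) volume).measure_set_eq
    (isAddFundamentalDomain_Ioc h2 0 volume) hA (by
      rintro ⟨g, hg⟩
      obtain ⟨n, rfl⟩ := AddSubgroup.mem_zmultiples_iff.1 hg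
      ext x
      have : polarPt ρ (n • (2 * Real.pi) + x) = polarPt ρ x := by
        rw [add_comm]; exact (polarPt_periodic ρ).zsmul n x
      simp only [mem_preimage, mem_ofPred_eq, AddSubgroup.mk_vadd, vadd_eq_add, this])
  calc _ ≤ volume ({θ | polarPt ρ θ ∈ S} ∩ Ioc (-Real.pi) (-Real.pi + 2 * Real.pi)) := by
        apply measure_mono
        rintro x ⟨hx, h1, h3⟩
        exact ⟨hx, h1, by linarith⟩
    _ = _ := key
    _ = volume ({θ | polarPt ρ θ ∈ S} ∩ Ico 0 (2 * Real.pi)) := by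
        rw [zero_add]
        exact measure_congr ((ae_eq_refl _).inter Ico_ae_eq_Ioc.symm)
    _ = _ := by
        congr 1; ext x; simp [and_comm]

theorem half_circle (k : ℝ → ℝ) (hk : Continuous k) (hp : Function.Periodic k Real.pi)
    (h0 : ∫ θ in (0:ℝ)..(2 * Real.pi), k θ = 0) :
    ∫ θ in Ioo (-Real.pi) Real.pi, (Iio (0:ℝ)).indicator k θ = 0 := by
  rw [setIntegral_indicator measurableSet_Iio]
  have h1 : Ioo (-Real.pi) Real.pi ∩ Iio 0 = Ioo (-Real.pi) 0 := by
    ext x; simp only [mem_inter_iff, mem_Ioo, mem_Iio]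
    have := Real.pi_pos
    constructor
    · rintro ⟨⟨a, b⟩, c⟩; exact ⟨a, c⟩
    · rintro ⟨a, b⟩; exact ⟨⟨a, by linarith⟩, b⟩
  rw [h1, ← integral_Ioc_eq_integral_Ioo, ← intervalIntegral.integral_of_le
    (by linarith [Real.pi_pos])]
  have e1 := hp.intervalIntegral_add_eq (-Real.pi) 0
  have e2 := hp.intervalIntegral_add_eq Real.pi 0
  have e3 := intervalIntegral.integral_add_adjacent_intervals
    (hk.intervalIntegrable (μ := volume) 0 Real.pi)
    (hk.intervalIntegrable (μ := volume) Real.pi (2 * Real.pi))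
  rw [neg_add_cancel, zero_add] at e1
  rw [zero_add, ← two_mul] at e2
  linarith


theorem stmt15 (K : EuclideanSpace ℝ (Fin 2) → ℝ)
    (hcont : ContinuousOn K {x | x ≠ 0})
    (heven : ∀ x : EuclideanSpace ℝ (Fin 2), x ≠ 0 → K (-x) = K x)
    (hhom : ∀ l : ℝ, 0 < l → ∀ x : EuclideanSpace ℝ (Fin 2), x ≠ 0 →
      K (l • x) = (l ^ 2)⁻¹ * K x)
    (hmean : ∫ θ in (0:ℝ)..(2 * Real.pi),
      K ((WithLp.equiv 2 (Fin 2 → ℝ)).symm ![Real.cos θ, Real.sin θ]) = 0)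
    (M : ℝ) (hM : ∀ x : EuclideanSpace ℝ (Fin 2), ‖x‖ = 1 → |K x| ≤ M)
    (D : Set (EuclideanSpace ℝ (Fin 2))) (hD : MeasurableSet D)
    (ε δ : ℝ) (hε : 0 < ε) (hεδ : ε < δ) :
    ENNReal.ofReal |∫ y in D ∩ {y | ε < ‖y‖ ∧ ‖y‖ < δ}, K y| ≤
      ENNReal.ofReal M *
        ∫⁻ ρ in Set.Ioo (0:ℝ) δ,
          (MeasureTheory.volume {θ ∈ Set.Ico (0:ℝ) (2 * Real.pi) |
              (WithLp.equiv 2 (Fin 2 → ℝ)).symm ![ρ * Real.cos θ, ρ * Real.sin θ] ∈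
                (D \ {y : EuclideanSpace ℝ (Fin 2) | y 1 < 0}) ∪
                ({y : EuclideanSpace ℝ (Fin 2) | y 1 < 0} \ D)}) / ENNReal.ofReal ρ := by
  have hM0 : 0 ≤ M := (abs_nonneg _).trans (hM (polarPt 1 0) (polarPt_norm one_pos 0))
  set H : Set (EuclideanSpace ℝ (Fin 2)) := {y | y 1 < 0} with hHdef
  set A : Set (EuclideanSpace ℝ (Fin 2)) := {y | ε < ‖y‖ ∧ ‖y‖ < δ} with hAdef
  have hH : MeasurableSet H := by
    apply IsOpen.measurableSet
    exact isOpen_lt (by fun_prop) continuous_const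
  have hA : MeasurableSet A := by
    apply IsOpen.measurableSet
    exact (isOpen_lt continuous_const continuous_norm).inter
      (isOpen_lt continuous_norm continuous_const)
  set S : Set (EuclideanSpace ℝ (Fin 2)) := (D \ H) ∪ (H \ D) with hSdef
  have hS : MeasurableSet S := (hD.diff hH).union (hH.diff hD)
  have hA0 : ∀ y ∈ A, y ≠ 0 := fun y hy => norm_pos_iff.1 (hε.trans hy.1)
  -- pointwise bound
  have hbd : ∀ y : EuclideanSpace ℝ (Fin 2), y ≠ 0 → |K y| ≤ M / ‖y‖ ^ 2 := by
    intro y hy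
    have hn : 0 < ‖y‖ := norm_pos_iff.2 hy
    have h1 : ‖(‖y‖⁻¹ • y)‖ = 1 := by
      rw [norm_smul, norm_inv, norm_norm, inv_mul_cancel₀ hn.ne']
    have h2 := hhom ‖y‖ hn (‖y‖⁻¹ • y) (by rw [← norm_pos_iff, h1]; exact one_pos)
    rw [smul_inv_smul₀ hn.ne'] at h2
    rw [h2, abs_mul, abs_of_pos (by positivity), div_eq_inv_mul]
    exact mul_le_mul_of_nonneg_left (hM _ h1) (by positivity)
  have hKpol : ∀ ρ : ℝ, 0 < ρ → ∀ θ, K (polarPt ρ θ) = (ρ ^ 2)⁻¹ * K (polarPt 1 θ) := by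
    intro ρ hρ θ
    rw [polarPt_smul, hhom ρ hρ _ (polarPt_ne one_pos θ)]
  -- integrability
  have hint : IntegrableOn K A := by
    refine IntegrableOn.of_bound ?_ ?_ (M / ε ^ 2) ?_
    · refine lt_of_le_of_lt (measure_mono fun y hy => ?_)
        (measure_ball_lt_top (x := (0 : EuclideanSpace ℝ (Fin 2))) (r := δ))
      simpa using hy.2
    · exact (hcont.mono hA0).aestronglyMeasurable hA
    · filter_upwards [ae_restrict_mem hA] with y hy
      refine (hbd y (hA0 y hy)).trans ?_
      have := hy.1
      gcongr
  -- the half-plane part vanishes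
  have hzero : ∫ y in H ∩ A, K y = 0 := by
    rw [← integral_indicator (hH.inter hA), polar_integral]
    have hk : Continuous fun θ => K (polarPt 1 θ) :=
      hcont.comp_continuous (polarPt_continuous.comp (Continuous.prodMk_right 1))
        (fun θ => polarPt_ne one_pos θ)
    have hkp : Function.Periodic (fun θ => K (polarPt 1 θ)) Real.pi := by
      intro θ
      simp only [polarPt_add_pi, heven _ (polarPt_ne one_pos θ)]
    have hm : ∫ θ in (0:ℝ)..(2 * Real.pi), K (polarPt 1 θ) = 0 := by
      simpa only [polarPt, one_mul] using hmean
    have hh := half_circle _ hk hkp hm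
    have hprod := setIntegral_prod_mul (μ := (volume : Measure ℝ)) (ν := (volume : Measure ℝ))
      ((Ioo ε δ).indicator fun ρ : ℝ => ρ * (ρ ^ 2)⁻¹)
      ((Iio (0:ℝ)).indicator fun θ => K (polarPt 1 θ)) (Ioi 0) (Ioo (-Real.pi) Real.pi)
    rw [hh, mul_zero] at hprod
    refine Eq.trans ?_ hprod
    refine setIntegral_congr_fun (measurableSet_Ioi.prod measurableSet_Ioo) ?_
    rintro ⟨ρ, θ⟩ ⟨hρ, hθ1, hθ2⟩
    simp only [mem_Ioi] at hρ hθ1 hθ2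
    have hmA : polarPt ρ θ ∈ A ↔ ρ ∈ Ioo ε δ := by
      simp only [hAdef, mem_ofPred_eq, polarPt_norm hρ, mem_Ioo]
    have hmH : polarPt ρ θ ∈ H ↔ θ ∈ Iio (0:ℝ) := by
      have : polarPt ρ θ 1 = ρ * Real.sin θ := by simp [polarPt]
      simp only [hHdef, mem_ofPred_eq, this, mem_Iio]
      constructor
      · intro h
        by_contra! h0
        have := Real.sin_nonneg_of_nonneg_of_le_pi h0 hθ2.le
        have := mul_nonneg hρ.le this
        linarith
      · intro h
        exact mul_neg_of_pos_of_neg hρ (Real.sin_neg_of_neg_of_neg_pi_lt h hθ1)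
    by_cases h1 : ρ ∈ Ioo ε δ <;> by_cases h2 : θ ∈ Iio (0:ℝ)
    · have hmem : polarPt ρ θ ∈ H ∩ A := ⟨hmH.2 h2, hmA.2 h1⟩
      simp only [indicator_of_mem hmem]
      simp only [indicator_of_mem h1, indicator_of_mem h2, hKpol ρ hρ]
      ring
    all_goals
      have hmem : polarPt ρ θ ∉ H ∩ A := fun h => by
        first
        | exact h1 (hmA.1 h.2)
        | exact h2 (hmH.1 h.1)
      simp only [indicator_of_notMem hmem]
      first
      | simp only [indicator_of_notMem h1, mul_zero, zero_mul]
      | simp only [indicator_of_notMem h2, mul_zero, zero_mul]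
  -- main estimate
  have hdiff : ∫ y in D ∩ A, K y =
      ∫ y, ((D ∩ A).indicator K y - (H ∩ A).indicator K y) := by
    rw [integral_sub, integral_indicator (hD.inter hA), integral_indicator (hH.inter hA), hzero,
      sub_zero]
    · exact (hint.mono_set inter_subset_right).integrable_indicator (hD.inter hA)
    · exact (hint.mono_set inter_subset_right).integrable_indicator (hH.inter hA)
  let G : EuclideanSpace ℝ (Fin 2) → ENNReal :=
    (A ∩ S).indicator fun y => ENNReal.ofReal (M / ‖y‖ ^ 2)
  have hG : Measurable G := by
    refine Measurable.indicator ?_ (hA.inter hS)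
    fun_prop
  have hb : ∀ y, ‖(D ∩ A).indicator K y - (H ∩ A).indicator K y‖ₑ ≤ G y := by
    intro y
    have hb2 : y ∈ A → ‖K y‖ₑ ≤ ENNReal.ofReal (M / ‖y‖ ^ 2) := by
      intro hy
      rw [Real.enorm_eq_ofReal_abs]
      exact ENNReal.ofReal_le_ofReal (hbd y (hA0 y hy))
    by_cases hy : y ∈ A <;> by_cases h1 : y ∈ D <;> by_cases h2 : y ∈ H <;>
      simp [G, hSdef, hy, h1, h2, hb2]
  calc ENNReal.ofReal |∫ y in D ∩ A, K y|
      = ‖∫ y, ((D ∩ A).indicator K y - (H ∩ A).indicator K y)‖ₑ := by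
        rw [hdiff, Real.enorm_eq_ofReal_abs]
    _ ≤ ∫⁻ y, ‖(D ∩ A).indicator K y - (H ∩ A).indicator K y‖ₑ :=
        enorm_integral_le_lintegral_enorm _
    _ ≤ ∫⁻ y, G y := lintegral_mono hb
    _ = ∫⁻ ρ in Ioi (0:ℝ), ∫⁻ θ in Ioo (-Real.pi) Real.pi,
          ENNReal.ofReal ρ * G (polarPt ρ θ) := by
        rw [polar_lintegral, Measure.volume_eq_prod, setLIntegral_prod]
        have : Measurable fun p : ℝ × ℝ => ENNReal.ofReal p.1 * G (polarPt p.1 p.2) :=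
          (ENNReal.measurable_ofReal.comp measurable_fst).mul
            (hG.comp polarPt_continuous.measurable)
        exact this.aemeasurable
    _ ≤ ∫⁻ ρ in Ioi (0:ℝ), (Ioo 0 δ).indicator (fun ρ => ENNReal.ofReal M *
          (volume {θ ∈ Ico (0:ℝ) (2 * Real.pi) | polarPt ρ θ ∈ S} / ENNReal.ofReal ρ)) ρ := by
        refine setLIntegral_mono' measurableSet_Ioi fun ρ hρ => ?_
        have hρ : 0 < ρ := hρ
        by_cases hρδ : ρ < δ
        · have hmem : ρ ∈ Ioo 0 δ := ⟨hρ, hρδ⟩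
          rw [indicator_of_mem hmem]
          have hmS : MeasurableSet {θ | polarPt ρ θ ∈ S} :=
            (polarPt_continuous.comp (Continuous.prodMk_right ρ)).measurable hS
          calc _ ≤ ∫⁻ θ in Ioo (-Real.pi) Real.pi,
                {θ | polarPt ρ θ ∈ S}.indicator
                  (fun _ => ENNReal.ofReal M * (ENNReal.ofReal ρ)⁻¹) θ := by
                refine lintegral_mono fun θ => ?_
                by_cases hm : polarPt ρ θ ∈ A ∩ S
                · have hm2 : θ ∈ {θ | polarPt ρ θ ∈ S} := hm.2
                  simp only [G]
                  rw [indicator_of_mem hm, indicator_of_mem hm2,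
                    polarPt_norm hρ, ← ENNReal.ofReal_mul hρ.le, ← ENNReal.ofReal_inv_of_pos hρ,
                    ← ENNReal.ofReal_mul hM0]
                  apply le_of_eq
                  congr 1
                  field_simp
                · simp [G, indicator_of_notMem hm]
            _ = ENNReal.ofReal M * (ENNReal.ofReal ρ)⁻¹ *
                volume ({θ | polarPt ρ θ ∈ S} ∩ Ioo (-Real.pi) Real.pi) := by
                rw [lintegral_indicator_const hmS, Measure.restrict_apply hmS]
            _ ≤ ENNReal.ofReal M * (ENNReal.ofReal ρ)⁻¹ *
                volume {θ ∈ Ico (0:ℝ) (2 * Real.pi) | polarPt ρ θ ∈ S} := by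
                exact mul_le_mul_right (measure_shift ρ S hS) _
            _ = _ := by
                rw [div_eq_mul_inv, mul_assoc, mul_comm (ENNReal.ofReal ρ)⁻¹]
        · have : ∀ θ, G (polarPt ρ θ) = 0 := by
            intro θ
            refine indicator_of_notMem (fun h => hρδ ?_) _
            have := h.1.2
            rwa [polarPt_norm hρ] at this
          simp [this]
    _ = _ := by
        rw [setLIntegral_indicator measurableSet_Ioo, inter_eq_left.2 Ioo_subset_Ioi_self,
          lintegral_const_mul' _ _ ENNReal.ofReal_ne_top]
        rfl
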